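/- Let n ≥ 4 and let 𝔫_ℂ be the real Lie algebra of strictly upper triangular n×n complex matrices, with bracket [A,B] = AB − BA and grading by superdiagonals V_i = {A ∈ 𝔫_ℂ : A_{jk} = 0 whenever k − j ≠ i}. Then every graded automorphism of 𝔫_ℂ (i.e. every ℝ-linear Lie algebra automorphism φ with φ(V_i) = V_i for all i) is either complex linear or complex antilinear. -/

import Mathlib

/-- The real Lie algebra `𝔫_ℂ` of strictly upper triangular `n×n` complex
matrices, as a real submodule. -/
noncomputable def strictlyUpperC (n : ℕ) : Submodule ℝ (Matrix (Fin n) (Fin n) ℂ) where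
  carrier := {A | ∀ i j : Fin n, j ≤ i → A i j = 0}
  add_mem' := fun ha hb i j h => by
    simp only [Matrix.add_apply, ha i j h, hb i j h, add_zero]
  zero_mem' := fun i j _ => rfl
  smul_mem' := fun c A hA i j h => by
    simp only [Matrix.smul_apply, hA i j h, smul_zero]

/-- The `i`-th layer `V_i` of the grading of `𝔫_ℂ`. -/
noncomputable def superdiagC (n i : ℕ) : Submodule ℝ (Matrix (Fin n) (Fin n) ℂ) where
  carrier := {A | ∀ a b : Fin n, (b : ℕ) ≠ (a : ℕ) + i → A a b = 0}
  add_mem' := fun ha hb a b h => by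
    simp only [Matrix.add_apply, ha a b h, hb a b h, add_zero]
  zero_mem' := fun a b _ => rfl
  smul_mem' := fun c A hA a b h => by
    simp only [Matrix.smul_apply, hA a b h, smul_zero]

open Matrix in
theorem single_mem_strictlyUpperC {n : ℕ} {a b : Fin n} (h : a < b) (z : ℂ) :
    single a b z ∈ strictlyUpperC n := by
  intro i j hij
  rw [single_apply, if_neg]
  rintro ⟨rfl, rfl⟩
  exact absurd hij (not_le.mpr h)

open Matrix in
theorem single_mem_superdiagC_one {n : ℕ} {a b : Fin n} (h : (b : ℕ) = a + 1) (z : ℂ) :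
    single a b z ∈ superdiagC n 1 := by
  intro i j hij
  rw [single_apply, if_neg]
  rintro ⟨rfl, rfl⟩
  exact hij h

theorem superdiagC_one_le_strictlyUpperC (n : ℕ) : superdiagC n 1 ≤ strictlyUpperC n := by
  intro A hA i j hij
  apply hA
  have : (j : ℕ) ≤ i := hij
  omega

theorem commutator_mem_strictlyUpperC {n : ℕ} {A B : Matrix (Fin n) (Fin n) ℂ}
    (hA : A ∈ strictlyUpperC n) (hB : B ∈ strictlyUpperC n) :
    A * B - B * A ∈ strictlyUpperC n := by
  intro i j hij
  rw [Matrix.sub_apply, Matrix.mul_apply, Matrix.mul_apply, Finset.sum_eq_zero,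
    Finset.sum_eq_zero, sub_zero]
  all_goals
    intro k _
    rcases le_or_gt k i with h | h
    · simp [hA i k h, hB i k h]
    · simp [hA k j (hij.trans h.le), hB k j (hij.trans h.le)]

open Matrix in
theorem mul_single_apply_eq_ite {n : ℕ} (M : Matrix (Fin n) (Fin n) ℂ) (p q i j : Fin n) (w : ℂ) :
    (M * single p q w) i j = if j = q then M i p * w else 0 := by
  split_ifs with h
  · subst h; simp
  · simp [h]

open Matrix in
theorem single_mul_apply_eq_ite {n : ℕ} (M : Matrix (Fin n) (Fin n) ℂ) (p q i j : Fin n) (w : ℂ) :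
    (single p q w * M) i j = if i = p then w * M q j else 0 := by
  split_ifs with h
  · subst h; simp
  · simp [h]

open Matrix in
/-- A map `T` of the first layer with `[T x, y] = [x, T y]` and `[T x, y] = 0` whenever
`[x, y] = 0` preserves each line `ℂ E_{a,a+1}`. -/
theorem eq_single_of_commutator_symm {n : ℕ}
    {T : Matrix (Fin n) (Fin n) ℂ → Matrix (Fin n) (Fin n) ℂ}
    (hT : ∀ x ∈ superdiagC n 1, T x ∈ superdiagC n 1)
    (hsymm : ∀ x ∈ superdiagC n 1, ∀ y ∈ superdiagC n 1,
      T x * y - y * T x = x * T y - T y * x)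
    (hzero : ∀ x ∈ superdiagC n 1, ∀ y ∈ superdiagC n 1,
      x * y - y * x = 0 → T x * y - y * T x = 0)
    {a b : Fin n} (hab : (b : ℕ) = a + 1) (z : ℂ) :
    T (single a b z) = single a b (T (single a b z) a b) := by
  have hne : a ≠ b := fun h => by simp [h] at hab
  have hx := single_mem_superdiagC_one hab z
  have hself := hzero _ hx _ (single_mem_superdiagC_one hab 1) (by simp [hne.symm])
  have hsymm' := hsymm _ hx
  have hM := hT _ hx
  set M := T (single a b z)
  ext u v
  rw [single_apply]
  split_ifs with h
  · rw [h.1, h.2]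
  by_cases huv : (v : ℕ) = u + 1
  swap
  · exact hM u v huv
  have hua : (u : ℕ) ≠ a := fun h' => h ⟨Fin.ext h'.symm, Fin.ext (by omega)⟩
  have hu := u.isLt
  have hv := v.isLt
  have ha := a.isLt
  rcases lt_or_gt_of_ne hua with hlt | hgt
  · by_cases hva : v = a
    · subst hva
      have := congrFun (congrFun hself u) b
      rw [Matrix.sub_apply, mul_single_apply_eq_ite, single_mul_apply_eq_ite, if_pos rfl,
        if_neg (fun h' => hua (congrArg Fin.val h'))] at this
      simpa using this
    · have hva' : (v : ℕ) ≠ a := fun h' => hva (Fin.ext h')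
      have := congrFun (congrFun (hsymm' _ (single_mem_superdiagC_one
        (a := v) (b := ⟨v + 1, by omega⟩) rfl 1)) u) ⟨v + 1, by omega⟩
      rw [Matrix.sub_apply, Matrix.sub_apply, mul_single_apply_eq_ite, single_mul_apply_eq_ite,
        mul_single_apply_eq_ite, single_mul_apply_eq_ite, if_pos rfl,
        if_neg (by rw [Fin.ext_iff]; omega), if_neg (by rw [Fin.ext_iff]; omega),
        if_neg (by simp only [Fin.ext_iff]; omega)] at this
      simpa using this
  · by_cases hub : u = b
    · subst hub
      have := congrFun (congrFun hself a) v
      rw [Matrix.sub_apply, mul_single_apply_eq_ite, single_mul_apply_eq_ite,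
        if_neg (by rw [Fin.ext_iff]; omega), if_pos rfl] at this
      simpa using this
    · have hub' : (u : ℕ) ≠ b := fun h' => hub (Fin.ext h')
      have := congrFun (congrFun (hsymm' _ (single_mem_superdiagC_one
        (a := ⟨u - 1, by omega⟩) (b := u) (by simp only []; omega) 1)) ⟨u - 1, by omega⟩) v
      rw [Matrix.sub_apply, Matrix.sub_apply, mul_single_apply_eq_ite, single_mul_apply_eq_ite,
        mul_single_apply_eq_ite, single_mul_apply_eq_ite, if_pos rfl,
        if_neg (by rw [Fin.ext_iff]; omega), if_neg (by simp only [Fin.ext_iff]; omega),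
        if_neg (by rw [Fin.ext_iff]; omega)] at this
      simpa using this

open Matrix in
/-- Under the hypotheses of `eq_single_of_commutator_symm`, the map `T` is multiplication by one
complex scalar on all the lines `ℂ E_{a,a+1}`. -/
theorem exists_eq_single_mul_of_commutator_symm {n : ℕ} (hn : 3 ≤ n)
    {T : Matrix (Fin n) (Fin n) ℂ → Matrix (Fin n) (Fin n) ℂ}
    (hT : ∀ x ∈ superdiagC n 1, T x ∈ superdiagC n 1)
    (hsymm : ∀ x ∈ superdiagC n 1, ∀ y ∈ superdiagC n 1,
      T x * y - y * T x = x * T y - T y * x)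
    (hzero : ∀ x ∈ superdiagC n 1, ∀ y ∈ superdiagC n 1,
      x * y - y * x = 0 → T x * y - y * T x = 0) :
    ∃ κ : ℂ, ∀ a b : Fin n, (b : ℕ) = a + 1 → ∀ z : ℂ,
      T (single a b z) = single a b (κ * z) := by
  have key : ∀ a b c : Fin n, (b : ℕ) = a + 1 → (c : ℕ) = b + 1 → ∀ z w : ℂ,
      T (single a b z) a b * w = z * T (single b c w) b c := by
    intro a b c hab hbc z w
    have := congrFun (congrFun (hsymm _ (single_mem_superdiagC_one hab z) _
      (single_mem_superdiagC_one hbc w)) a) c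
    rw [Matrix.sub_apply, Matrix.sub_apply, mul_single_apply_eq_ite, single_mul_apply_eq_ite,
      mul_single_apply_eq_ite, single_mul_apply_eq_ite, if_pos rfl, if_pos rfl,
      if_neg (by rw [Fin.ext_iff]; omega), if_neg (by rw [Fin.ext_iff]; omega)] at this
    simpa using this
  let e0 : Fin n := ⟨0, by omega⟩
  let e1 : Fin n := ⟨1, by omega⟩
  let e2 : Fin n := ⟨2, by omega⟩
  refine ⟨T (single e0 e1 1) e0 e1, fun a b hab z => ?_⟩
  rw [eq_single_of_commutator_symm hT hsymm hzero hab z]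
  congr 1
  obtain ⟨k, hk⟩ := a
  induction k generalizing b z with
  | zero =>
    obtain rfl : b = e1 := Fin.ext hab
    have h1 := key e0 e1 e2 rfl rfl z 1
    have h2 := key e0 e1 e2 rfl rfl 1 1
    simp only [mul_one, one_mul] at h1 h2
    rw [h2, mul_comm, ← h1]
  | succ k ih =>
    have h := key ⟨k, by omega⟩ ⟨k + 1, hk⟩ b rfl hab 1 z
    rw [one_mul, ih ⟨k + 1, hk⟩ 1 (by omega) rfl, mul_one] at h
    exact h.symm

open Matrix in
/-- If a bracket-preserving map turns multiplication by `κ` into multiplication by `μ` on the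
generators `z E_{a,a+1}`, then it does so on all strictly upper triangular matrices. -/
theorem map_smul_of_map_single_succ {n : ℕ}
    {φ : Matrix (Fin n) (Fin n) ℂ →ₗ[ℝ] Matrix (Fin n) (Fin n) ℂ}
    (hbracket : ∀ A ∈ strictlyUpperC n, ∀ B ∈ strictlyUpperC n,
      φ (A * B - B * A) = φ A * φ B - φ B * φ A) {κ μ : ℂ}
    (h : ∀ a b : Fin n, (b : ℕ) = a + 1 → ∀ z : ℂ,
      φ (single a b (κ * z)) = μ • φ (single a b z))
    {A : Matrix (Fin n) (Fin n) ℂ} (hA : A ∈ strictlyUpperC n) :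
    φ (κ • A) = μ • φ A := by
  have hsingle : ∀ k : ℕ, ∀ a b : Fin n, (b : ℕ) = a + (k + 1) → ∀ z : ℂ,
      φ (single a b (κ * z)) = μ • φ (single a b z) := by
    intro k
    induction k with
    | zero => exact h
    | succ k ih =>
      intro a b hab z
      have hb := b.isLt
      let c : Fin n := ⟨a + (k + 1), by omega⟩
      have hac : a < c := by rw [Fin.lt_def]; simp only [c]; omega
      have hcb : c < b := by rw [Fin.lt_def]; simp only [c]; omega
      have hcomm : ∀ w : ℂ, φ (single a b w) =
          φ (single a c w) * φ (single c b 1) - φ (single c b 1) * φ (single a c w) := by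
        intro w
        rw [← hbracket _ (single_mem_strictlyUpperC hac w) _ (single_mem_strictlyUpperC hcb 1)]
        simp [(hac.trans hcb).ne']
      rw [hcomm, hcomm, ih a c rfl, smul_sub, Matrix.smul_mul, Matrix.mul_smul]
  rw [matrix_eq_sum_single A]
  simp only [Finset.smul_sum, map_sum, smul_single, smul_eq_mul]
  refine Finset.sum_congr rfl fun i _ => Finset.sum_congr rfl fun j _ => ?_
  rcases le_or_gt j i with hji | hij
  · simp [hA i j hji]
  · have : (i : ℕ) < j := hij
    exact hsingle (j - i - 1) i j (by omega) _

theorem map_smul_eq_of_map_I_smul {E F : Type*} [AddCommGroup E] [AddCommGroup F]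
    [Module ℂ E] [Module ℂ F] (φ : E →ₗ[ℝ] F) {μ : ℂ} {x : E}
    (h : φ (Complex.I • x) = μ • φ x) (c : ℂ) :
    φ (c • x) = ((c.re : ℂ) + c.im * μ) • φ x := by
  conv_lhs => rw [← Complex.re_add_im c]
  rw [add_smul, mul_smul, map_add, Complex.coe_smul, Complex.coe_smul, map_smul, map_smul, h,
    add_smul, mul_smul, Complex.coe_smul, Complex.coe_smul]

/-- Every graded automorphism of `𝔫_ℂ` (for `n ≥ 4`) is either complex linear
or complex antilinear. -/
theorem graded_automorphism_complex_linear_or_antilinear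
    (n : ℕ) (hn : 4 ≤ n)
    (φ : Matrix (Fin n) (Fin n) ℂ →ₗ[ℝ] Matrix (Fin n) (Fin n) ℂ)
    (hgraded : ∀ i : ℕ, 1 ≤ i → Submodule.map φ (superdiagC n i) = superdiagC n i)
    (hbracket : ∀ A ∈ strictlyUpperC n, ∀ B ∈ strictlyUpperC n,
      φ (A * B - B * A) = φ A * φ B - φ B * φ A)
    (hinj : ∀ A ∈ strictlyUpperC n, φ A = 0 → A = 0) :
    (∀ c : ℂ, ∀ A ∈ strictlyUpperC n, φ (c • A) = c • φ A) ∨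
    (∀ c : ℂ, ∀ A ∈ strictlyUpperC n, φ (c • A) = (starRingEnd ℂ c) • φ A) := by
  have hle := superdiagC_one_le_strictlyUpperC n
  have hex : ∀ x : Matrix (Fin n) (Fin n) ℂ, ∃ y, x ∈ superdiagC n 1 →
      y ∈ superdiagC n 1 ∧ φ y = Complex.I • φ x := by
    intro x
    by_cases hx : x ∈ superdiagC n 1
    · have hφx : φ x ∈ superdiagC n 1 := by
        rw [← hgraded 1 le_rfl]
        exact Submodule.mem_map_of_mem hx
      have hI : Complex.I • φ x ∈ superdiagC n 1 := fun a b hab => by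
        rw [Matrix.smul_apply, hφx a b hab, smul_zero]
      rw [← hgraded 1 le_rfl] at hI
      obtain ⟨y, hy, hyx⟩ := hI
      exact ⟨y, fun _ => ⟨hy, hyx⟩⟩
    · exact ⟨0, fun h => absurd h hx⟩
  choose T hT using hex
  have hleft : ∀ x ∈ superdiagC n 1, ∀ y ∈ superdiagC n 1,
      φ (T x * y - y * T x) = Complex.I • φ (x * y - y * x) := by
    intro x hx y hy
    rw [hbracket _ (hle (hT x hx).1) _ (hle hy), hbracket _ (hle hx) _ (hle hy), (hT x hx).2,
      smul_sub, Matrix.smul_mul, Matrix.mul_smul]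
  have hright : ∀ x ∈ superdiagC n 1, ∀ y ∈ superdiagC n 1,
      φ (x * T y - T y * x) = Complex.I • φ (x * y - y * x) := by
    intro x hx y hy
    rw [← neg_sub, map_neg, hleft y hy x hx, ← neg_sub (x * y), map_neg, smul_neg, neg_neg]
  obtain ⟨κ, hκ⟩ := exists_eq_single_mul_of_commutator_symm (by omega : 3 ≤ n)
    (fun x hx => (hT x hx).1)
    (fun x hx y hy => sub_eq_zero.mp <| hinj _
      (sub_mem (commutator_mem_strictlyUpperC (hle (hT x hx).1) (hle hy))
        (commutator_mem_strictlyUpperC (hle hx) (hle (hT y hy).1)))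
      (by rw [map_sub, hleft x hx y hy, hright x hx y hy, sub_self]))
    (fun x hx y hy hxy => hinj _ (commutator_mem_strictlyUpperC (hle (hT x hx).1) (hle hy))
      (by rw [hleft x hx y hy, hxy, map_zero, smul_zero]))
  have hmap : ∀ A ∈ strictlyUpperC n, φ (κ • A) = Complex.I • φ A := fun A hA =>
    map_smul_of_map_single_succ hbracket (fun a b hab z => by
      rw [← hκ a b hab z, (hT _ (single_mem_superdiagC_one hab z)).2]) hA
  have hκ_sq : κ * κ = Complex.I * Complex.I := by
    let a : Fin n := ⟨0, by omega⟩
    let b : Fin n := ⟨1, by omega⟩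
    have hab : a < b := Nat.zero_lt_one
    have hE : ∀ w : ℂ, Matrix.single a b w ∈ strictlyUpperC n := single_mem_strictlyUpperC hab
    have h := hinj (Matrix.single a b (κ * κ + 1)) (hE _) (by
      have h1 := hmap _ (hE κ)
      have h2 := hmap _ (hE 1)
      rw [Matrix.smul_single, smul_eq_mul] at h1 h2
      rw [mul_one] at h2
      rw [Matrix.single_add, map_add, h1, h2, smul_smul, Complex.I_mul_I, neg_one_smul,
        neg_add_cancel])
    have h' := congrFun (congrFun h a) b
    rw [Matrix.single_apply_same, Matrix.zero_apply] at h'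
    rw [Complex.I_mul_I]
    exact eq_neg_of_add_eq_zero_left h'
  rcases mul_self_eq_mul_self_iff.mp hκ_sq with rfl | rfl
  · left
    intro c A hA
    rw [map_smul_eq_of_map_I_smul φ (hmap A hA), Complex.re_add_im]
  · right
    intro c A hA
    have h : φ (Complex.I • A) = (-Complex.I) • φ A := by
      rw [neg_smul, ← hmap A hA, neg_smul, map_neg, neg_neg]
    rw [map_smul_eq_of_map_I_smul φ h]
    congr 1
    apply Complex.ext <;> simp
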